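/- The set {D, K, N·a0, δ} is a homogeneous system of parameters for F[V]^{SL2(F_p)}: the four invariants D, K, N·a0, δ are algebraically independent over F, and F[V] (hence also F[V]^{SL2(F_p)}) is a finitely generated module over the subalgebra F[D, K, N·a0, δ]. -/

import Mathlib

open MvPolynomial

noncomputable section

/-- The right action of the 2×2 matrix `g` over `F_p` on `F[V] = F[a₃,a₂,a₁,a₀]`
(with `aᵢ = X i`), given by the dual of the third symmetric power representation. -/
def act (p : ℕ) [Fact p.Prime] (F : Type) [Field F] [CharP F p]
    (g : Matrix (Fin 2) (Fin 2) (ZMod p)) :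
    MvPolynomial (Fin 4) F →ₐ[F] MvPolynomial (Fin 4) F :=
  letI c : ZMod p → MvPolynomial (Fin 4) F := fun x => C (ZMod.castHom (dvd_refl p) F x)
  letI al := c (g 0 0)
  letI be := c (g 0 1)
  letI ga := c (g 1 0)
  letI de := c (g 1 1)
  aeval ![
    de ^ 3 * X 0 + 3 * de ^ 2 * ga * X 1 + 3 * de * ga ^ 2 * X 2 + ga ^ 3 * X 3,
    de ^ 2 * be * X 0 + (de ^ 2 * al + 2 * de * be * ga) * X 1
      + (2 * de * ga * al + be * ga ^ 2) * X 2 + ga ^ 2 * al * X 3,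
    de * be ^ 2 * X 0 + (2 * de * be * al + be ^ 2 * ga) * X 1
      + (de * al ^ 2 + 2 * be * ga * al) * X 2 + ga * al ^ 2 * X 3,
    be ^ 3 * X 0 + 3 * be ^ 2 * al * X 1 + 3 * be * al ^ 2 * X 2 + al ^ 3 * X 3]

/-- The transfer with respect to the Sylow `p`-subgroup `P = ⟨σ⟩`,
`tr^P(f) = ∑_{τ ∈ P} (f)τ`, where the elements of `P` are the matrices `[[1,s],[0,1]]`. -/
def trP (p : ℕ) [Fact p.Prime] (F : Type) [Field F] [CharP F p]
    (f : MvPolynomial (Fin 4) F) : MvPolynomial (Fin 4) F :=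
  ∑ s : ZMod p, act p F !![1, s; 0, 1] f

/-- The relative transfer `tr_B^G(f) = ∑_{τ ∈ Q ∪ {η}} (f)τ`, using the coset
representatives `Q ∪ {η}` of the Borel subgroup `B` in `G = SL₂(F_p)`. -/
def trBG (p : ℕ) [Fact p.Prime] (F : Type) [Field F] [CharP F p]
    (f : MvPolynomial (Fin 4) F) : MvPolynomial (Fin 4) F :=
  (∑ s : ZMod p, act p F !![1, 0; s, 1] f) + act p F !![0, 1; -1, 0] f

/-- The full transfer `tr^G(f) = ∑_{τ ∈ SL₂(F_p)} (f)τ`. -/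
def trG (p : ℕ) [Fact p.Prime] (F : Type) [Field F] [CharP F p]
    (f : MvPolynomial (Fin 4) F) : MvPolynomial (Fin 4) F :=
  ∑ g : Matrix.SpecialLinearGroup (Fin 2) (ZMod p), act p F g.1 f

/-- `N = ∏_{τ ∈ P} (a₃)τ = ∏_{s ∈ F_p} (a₃ + 3s a₂ + 3s² a₁ + s³ a₀)`. -/
def Npoly (p : ℕ) [Fact p.Prime] (F : Type) [Field F] [CharP F p] :
    MvPolynomial (Fin 4) F :=
  ∏ s : ZMod p, act p F !![1, s; 0, 1] (X 3)

/-- The weight of the monomial `a₃^e₃ a₂^e₂ a₁^e₁ a₀^e₀`, i.e. `3e₃ + e₂ - e₁ - 3e₀`. -/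
def wt (d : Fin 4 →₀ ℕ) : ℤ :=
  3 * (d 3 : ℤ) + (d 2 : ℤ) - (d 1 : ℤ) - 3 * (d 0 : ℤ)

/-- `f` is isobaric of weight `lam` modulo `p - 1`: every monomial occurring in `f`
has weight congruent to `lam` modulo `p - 1`. -/
def Isobaric (p : ℕ) {F : Type} [Field F] (f : MvPolynomial (Fin 4) F) (lam : ℤ) : Prop :=
  ∀ d ∈ f.support, ((p : ℤ) - 1) ∣ (wt d - lam)

/-- Strict grevlex comparison on exponent vectors, for the graded reverse
lexicographic order with `a₀ < a₁ < a₂ < a₃`. -/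
def grevlexLt (d e : Fin 4 →₀ ℕ) : Prop :=
  (∑ i : Fin 4, d i) < (∑ i : Fin 4, e i) ∨
    ((∑ i : Fin 4, d i) = (∑ i : Fin 4, e i) ∧
      ∃ k : Fin 4, e k < d k ∧ ∀ j : Fin 4, j < k → d j = e j)

/-- `d` is the lead monomial of `f` in the grevlex order with `a₀ < a₁ < a₂ < a₃`. -/
def LeadMonomialIs {F : Type} [Field F] (f : MvPolynomial (Fin 4) F) (d : Fin 4 →₀ ℕ) : Prop :=
  coeff d f ≠ 0 ∧ ∀ e ∈ f.support, e ≠ d → grevlexLt e d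

/-- The lead term of `f` is `c · x^d` in the grevlex order with `a₀ < a₁ < a₂ < a₃`. -/
def LeadTermIs {F : Type} [Field F] (f : MvPolynomial (Fin 4) F) (c : F) (d : Fin 4 →₀ ℕ) :
    Prop :=
  LeadMonomialIs f d ∧ coeff d f = c

/-- The discriminant `D` of the binary cubic. -/
def Dpoly (F : Type) [Field F] : MvPolynomial (Fin 4) F :=
  3 * X 2 ^ 2 * X 1 ^ 2 - 4 * X 3 * X 1 ^ 3 - 4 * X 2 ^ 3 * X 0
    + 6 * X 3 * X 2 * X 1 * X 0 - X 3 ^ 2 * X 0 ^ 2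

/-- `K = -tr^G(a₁^{p-1})`. -/
def Kpoly (p : ℕ) [Fact p.Prime] (F : Type) [Field F] [CharP F p] :
    MvPolynomial (Fin 4) F :=
  - trG p F (X 1 ^ (p - 1))

/-- Dickson's invariant `L = 3(a₂^p a₁ - a₂ a₁^p) - (a₃^p a₀ - a₃ a₀^p)`. -/
def Lpoly (p : ℕ) (F : Type) [Field F] : MvPolynomial (Fin 4) F :=
  3 * (X 2 ^ p * X 1 - X 2 * X 1 ^ p) - (X 3 ^ p * X 0 - X 3 * X 0 ^ p)

/-- `e = 2a₁³ + a₀(a₃a₀ - 3a₂a₁)`. -/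
def epoly (F : Type) [Field F] : MvPolynomial (Fin 4) F :=
  2 * X 1 ^ 3 + X 0 * (X 3 * X 0 - 3 * X 2 * X 1)

/-- `d = a₁² - a₂a₀`. -/
def dpoly (F : Type) [Field F] : MvPolynomial (Fin 4) F :=
  X 1 ^ 2 - X 2 * X 0

/-- `ξ = 3a₂² - 4a₃a₁`. -/
def xipoly (F : Type) [Field F] : MvPolynomial (Fin 4) F :=
  3 * X 2 ^ 2 - 4 * X 3 * X 1

/-- The ring of `SL₂(F_p)`-invariants `F[V]^{SL₂(F_p)}`, as a subalgebra of `F[V]`. -/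
def invariants (p : ℕ) [Fact p.Prime] (F : Type) [Field F] [CharP F p] :
    Subalgebra F (MvPolynomial (Fin 4) F) where
  carrier := {f | ∀ g : Matrix.SpecialLinearGroup (Fin 2) (ZMod p), act p F g.1 f = f}
  mul_mem' := fun hf hg g => by rw [map_mul, hf g, hg g]
  one_mem' := fun g => map_one _
  add_mem' := fun hf hg g => by rw [map_add, hf g, hg g]
  zero_mem' := fun g => map_zero _
  algebraMap_mem' := fun c g => (act _ _ _).commutes c

theorem fin_aux {F : Type} [Field F] (S : Subalgebra F (MvPolynomial (Fin 4) F))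
    {ι : Type} [Fintype ι] (θ : ι → MvPolynomial (Fin 4) F) (d : ι → ℕ) (hd : ∀ i, 0 < d i)
    (hθ : ∀ i, (θ i).IsHomogeneous (d i)) (hS : ∀ i, θ i ∈ S) (n : ℕ)
    (hX : ∀ i, (X i : MvPolynomial (Fin 4) F) ^ n ∈ Ideal.span (Set.range θ)) :
    Module.Finite S (MvPolynomial (Fin 4) F) := by
  classical
  set W : Set (Fin 4 →₀ ℕ) := {e | ∀ i, e i < n} with hW
  have hWf : W.Finite := by
    refine (Set.finite_Iic (Finsupp.equivFunOnFinite.symm fun _ : Fin 4 => n)).subset ?_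
    intro e he i
    simpa using (he i).le
  set M : Submodule S (MvPolynomial (Fin 4) F) :=
    Submodule.span S ((fun e => monomial e (1 : F)) '' W) with hM
  have hsmul : ∀ s ∈ S, ∀ m ∈ M, m * s ∈ M := by
    intro s hs m hm
    have := M.smul_mem (⟨s, hs⟩ : S) hm
    rwa [Subalgebra.smul_def, smul_eq_mul, mul_comm] at this
  have key : ∀ k : ℕ, ∀ g : MvPolynomial (Fin 4) F, g.IsHomogeneous k → g ∈ M := by
    intro k
    induction k using Nat.strong_induction_on with
    | _ k ih =>
    have hmon : ∀ e : Fin 4 →₀ ℕ, e.degree = k → monomial e (1 : F) ∈ M := by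
      intro e he
      by_cases hlt : ∀ i, e i < n
      · exact Submodule.subset_span ⟨e, hlt, rfl⟩
      push Not at hlt
      obtain ⟨i, hi⟩ := hlt
      obtain ⟨c, hc⟩ := Ideal.mem_span_range_iff_exists_fun.1 (hX i)
      have h1 : monomial e (1 : F) = ∑ j, (monomial (e - Finsupp.single i n) 1 * c j) * θ j := by
        simp_rw [mul_assoc]
        rw [← Finset.mul_sum, hc, X_pow_eq_monomial, monomial_mul, mul_one,
          tsub_add_cancel_of_le]
        simpa using hi
      have h2 : monomial e (1 : F) = homogeneousComponent k (monomial e (1 : F)) :=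
        (homogeneousComponent_eq_self (isHomogeneous_monomial _ he)).symm
      rw [h2, h1, map_sum]
      refine M.sum_mem fun j _ => ?_
      have h3 : ∀ a : MvPolynomial (Fin 4) F, homogeneousComponent k (a * θ j) =
          if d j ≤ k then homogeneousComponent (k - d j) a * θ j else 0 := by
        intro a
        let _ := MvPolynomial.gradedAlgebra (σ := Fin 4) (R := F)
        have := DirectSum.coe_decompose_mul_of_right_mem (homogeneousSubmodule (Fin 4) F) k
          (a := a) (b := θ j) (i := d j) ((mem_homogeneousSubmodule _ _).2 (hθ j))
        rw [← decomposition.decompose'_apply, ← decomposition.decompose'_apply]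
        exact this
      rw [h3]
      split_ifs with hle
      · exact hsmul _ (hS j) _ (ih _ (by have := hd j; omega) _
          (homogeneousComponent_isHomogeneous _ _))
      · exact M.zero_mem
    intro g hg
    rw [g.as_sum]
    refine M.sum_mem fun e he => ?_
    have : monomial e (coeff e g) = monomial e (1 : F) * C (coeff e g) := by
      rw [mul_comm, C_mul_monomial, mul_one]
    rw [this]
    refine hsmul _ (S.algebraMap_mem _) _ (hmon e ?_)
    by_contra hne
    exact (mem_support_iff.1 he) (hg.coeff_eq_zero hne)
  refine ⟨Submodule.fg_def.2 ⟨_, hWf.image (fun e => monomial e (1 : F)), ?_⟩⟩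
  rw [eq_top_iff]
  intro g _
  change g ∈ M
  rw [← sum_homogeneousComponent g]
  exact M.sum_mem fun k _ => key k _ (homogeneousComponent_isHomogeneous _ _)

theorem algInd_aux {F : Type} [Field F] (x : Fin 4 → MvPolynomial (Fin 4) F)
    (h : Module.Finite (Algebra.adjoin F (Set.range x)) (MvPolynomial (Fin 4) F)) :
    AlgebraicIndependent F x := by
  have : Algebra.IsAlgebraic (Algebra.adjoin F (Set.range x)) (MvPolynomial (Fin 4) F) :=
    inferInstance
  refine (Algebra.IsAlgebraic.isTranscendenceBasis_of_lift_le_trdeg_of_finite F x ?_).1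
  simp [MvPolynomial.trdeg_of_isDomain]

section hom
variable {p : ℕ} [Fact p.Prime] {F : Type} [Field F] [CharP F p]

/-- coefficients -/
def cc (p : ℕ) [Fact p.Prime] (F : Type) [Field F] [CharP F p] : ZMod p →+* F :=
  ZMod.castHom (dvd_refl p) F

theorem act_X0 (g : Matrix (Fin 2) (Fin 2) (ZMod p)) : act p F g (X 0) =
    C (cc p F (g 1 1)) ^ 3 * X 0 + 3 * C (cc p F (g 1 1)) ^ 2 * C (cc p F (g 1 0)) * X 1
      + 3 * C (cc p F (g 1 1)) * C (cc p F (g 1 0)) ^ 2 * X 2 + C (cc p F (g 1 0)) ^ 3 * X 3 :=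
  aeval_X _ _

theorem act_X1 (g : Matrix (Fin 2) (Fin 2) (ZMod p)) : act p F g (X 1) =
    C (cc p F (g 1 1)) ^ 2 * C (cc p F (g 0 1)) * X 0
      + (C (cc p F (g 1 1)) ^ 2 * C (cc p F (g 0 0))
        + 2 * C (cc p F (g 1 1)) * C (cc p F (g 0 1)) * C (cc p F (g 1 0))) * X 1
      + (2 * C (cc p F (g 1 1)) * C (cc p F (g 1 0)) * C (cc p F (g 0 0))
        + C (cc p F (g 0 1)) * C (cc p F (g 1 0)) ^ 2) * X 2
      + C (cc p F (g 1 0)) ^ 2 * C (cc p F (g 0 0)) * X 3 :=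
  aeval_X _ _

theorem act_X2 (g : Matrix (Fin 2) (Fin 2) (ZMod p)) : act p F g (X 2) =
    C (cc p F (g 1 1)) * C (cc p F (g 0 1)) ^ 2 * X 0
      + (2 * C (cc p F (g 1 1)) * C (cc p F (g 0 1)) * C (cc p F (g 0 0))
        + C (cc p F (g 0 1)) ^ 2 * C (cc p F (g 1 0))) * X 1
      + (C (cc p F (g 1 1)) * C (cc p F (g 0 0)) ^ 2
        + 2 * C (cc p F (g 0 1)) * C (cc p F (g 1 0)) * C (cc p F (g 0 0))) * X 2
      + C (cc p F (g 1 0)) * C (cc p F (g 0 0)) ^ 2 * X 3 :=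
  aeval_X _ _

theorem act_X3 (g : Matrix (Fin 2) (Fin 2) (ZMod p)) : act p F g (X 3) =
    C (cc p F (g 0 1)) ^ 3 * X 0 + 3 * C (cc p F (g 0 1)) ^ 2 * C (cc p F (g 0 0)) * X 1
      + 3 * C (cc p F (g 0 1)) * C (cc p F (g 0 0)) ^ 2 * X 2 + C (cc p F (g 0 0)) ^ 3 * X 3 :=
  aeval_X _ _

theorem act_C (g : Matrix (Fin 2) (Fin 2) (ZMod p)) (a : F) : act p F g (C a) = C a :=
  (act p F g).commutes a

theorem forall_fin4 {P : Fin 4 → Prop} (h0 : P 0) (h1 : P 1) (h2 : P 2) (h3 : P 3) :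
    ∀ i, P i := by
  intro i
  fin_cases i
  exacts [h0, h1, h2, h3]

theorem act_hom (g : Matrix (Fin 2) (Fin 2) (ZMod p)) (f : MvPolynomial (Fin 4) F) (n : ℕ)
    (hf : f.IsHomogeneous n) : (act p F g f).IsHomogeneous n := by
  have h : ∀ a b c d : F, (C a * X 0 + C b * X 1 + C c * X 2 + C d * X 3 :
      MvPolynomial (Fin 4) F).IsHomogeneous 1 := fun a b c d =>
    (((isHomogeneous_C_mul_X _ _).add (isHomogeneous_C_mul_X _ _)).add
      (isHomogeneous_C_mul_X _ _)).add (isHomogeneous_C_mul_X _ _)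
  have := hf.aeval (n := 1) (fun i => act p F g (X i)) ?_
  · rw [one_mul] at this
    convert this
    apply algHom_ext
    intro i
    simp
  · have h3 : (3 : MvPolynomial (Fin 4) F) = C 3 := (map_ofNat C 3).symm
    have h2 : (2 : MvPolynomial (Fin 4) F) = C 2 := (map_ofNat C 2).symm
    refine forall_fin4 ?_ ?_ ?_ ?_ <;>
    simp only [act_X0, act_X1, act_X2, act_X3, h3, h2, ← C_mul, ← C_pow, ← C_add] <;>
    exact h _ _ _ _

theorem act_act (g h : Matrix (Fin 2) (Fin 2) (ZMod p)) (f : MvPolynomial (Fin 4) F) :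
    act p F g (act p F h f) = act p F (h * g) f := by
  rw [← AlgHom.comp_apply]
  refine DFunLike.congr_fun (?_ : (act p F g).comp (act p F h) = act p F (h * g)) f
  apply algHom_ext
  refine forall_fin4 ?_ ?_ ?_ ?_ <;>
  · simp only [AlgHom.comp_apply, act_X0, act_X1, act_X2, act_X3, map_add, map_mul, map_pow,
      act_C, Matrix.mul_apply, Fin.sum_univ_two, map_ofNat]
    ring

theorem act_one (f : MvPolynomial (Fin 4) F) : act p F 1 f = f := by
  have : act p F 1 = AlgHom.id F _ := by
    apply algHom_ext
    refine forall_fin4 ?_ ?_ ?_ ?_ <;> simp [act_X0, act_X1, act_X2, act_X3]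
  rw [this]; rfl

theorem act_D (g : Matrix (Fin 2) (Fin 2) (ZMod p)) (hg : g.det = 1) :
    act p F g (Dpoly F) = Dpoly F := by
  have h : act p F g (Dpoly F) = C (cc p F g.det) ^ 6 * Dpoly F := by
    rw [Matrix.det_fin_two]
    simp only [Dpoly, act_X0, act_X1, act_X2, act_X3, map_add, map_sub, map_mul, map_pow,
      map_ofNat]
    generalize C (cc p F (g 0 0)) = a
    generalize C (cc p F (g 0 1)) = b
    generalize C (cc p F (g 1 0)) = c
    generalize C (cc p F (g 1 1)) = d
    ring
  rw [h, hg]; simp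

theorem act_K (g : Matrix.SpecialLinearGroup (Fin 2) (ZMod p)) :
    act p F g.1 (Kpoly p F) = Kpoly p F := by
  simp only [Kpoly, trG, map_neg, map_sum, act_act]
  refine congrArg Neg.neg ?_
  exact Fintype.sum_equiv (Equiv.mulRight g) _ _ (fun h => by simp)

end hom

section count
variable {p : ℕ} [Fact p.Prime]

theorem sum_pow_card : ∑ x : ZMod p, x ^ (p - 1) = -1 := by
  have hp := (Fact.out : p.Prime).two_le
  have h : ∀ x : ZMod p, x ^ (p - 1) = 1 - if x = 0 then 1 else 0 := by
    intro x
    split_ifs with hx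
    · rw [hx, zero_pow (by omega)]; simp
    · rw [ZMod.pow_card_sub_one_eq_one hx]; simp
  simp_rw [h]
  rw [Finset.sum_sub_distrib]
  simp

theorem inner_sum_aux (hp : 3 < p) (a : ZMod p) :
    ∑ d : ZMod p, (3 * a * d - 1) ^ (p - 1) = if a = 0 then 0 else -1 := by
  have h3 : (3 : ZMod p) ≠ 0 := by
    intro h
    have : ((3 : ℕ) : ZMod p) = 0 := by exact_mod_cast h
    rw [ZMod.natCast_eq_zero_iff] at this
    exact absurd (Nat.le_of_dvd (by norm_num) this) (by omega)
  split_ifs with ha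
  · simp [ha]
  · rw [← sum_pow_card (p := p)]
    have h3a : 3 * a ≠ 0 := mul_ne_zero h3 ha
    exact Fintype.sum_equiv ((Equiv.mulLeft₀ (3 * a) h3a).trans (Equiv.subRight 1)) _ _
      (fun d => by simp)

/-- parametrisation of the big cell -/
def cell (x : (ZMod p)ˣ × ZMod p × ZMod p) : Matrix.SpecialLinearGroup (Fin 2) (ZMod p) :=
  ⟨!![x.2.1, (x.2.1 * x.2.2 - 1) * (x.1⁻¹ : (ZMod p)ˣ); (x.1 : ZMod p), x.2.2], by
    rw [Matrix.det_fin_two_of, mul_assoc, Units.inv_mul]; ring⟩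

theorem cell00 (x : (ZMod p)ˣ × ZMod p × ZMod p) : (cell x).1 0 0 = x.2.1 := rfl
theorem cell01 (x : (ZMod p)ˣ × ZMod p × ZMod p) :
    (cell x).1 0 1 = (x.2.1 * x.2.2 - 1) * (x.1⁻¹ : (ZMod p)ˣ) := rfl
theorem cell10 (x : (ZMod p)ˣ × ZMod p × ZMod p) : (cell x).1 1 0 = x.1 := rfl
theorem cell11 (x : (ZMod p)ˣ × ZMod p × ZMod p) : (cell x).1 1 1 = x.2.2 := rfl

theorem sl2_sum (hp : 3 < p) :
    ∑ g : Matrix.SpecialLinearGroup (Fin 2) (ZMod p),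
      (2 * g.1 1 1 * g.1 1 0 * g.1 0 0 + g.1 0 1 * g.1 1 0 ^ 2) ^ (p - 1) = -1 := by
  classical
  have h1 : ∑ g : Matrix.SpecialLinearGroup (Fin 2) (ZMod p),
      (2 * g.1 1 1 * g.1 1 0 * g.1 0 0 + g.1 0 1 * g.1 1 0 ^ 2) ^ (p - 1) =
      ∑ g ∈ Finset.univ.filter
        (fun g : Matrix.SpecialLinearGroup (Fin 2) (ZMod p) => g.1 1 0 ≠ 0),
      (3 * g.1 0 0 * g.1 1 1 - 1) ^ (p - 1) := by
    rw [Finset.sum_filter]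
    refine Finset.sum_congr rfl fun g _ => ?_
    have hdet : g.1 0 0 * g.1 1 1 - g.1 0 1 * g.1 1 0 = 1 := by
      rw [← Matrix.det_fin_two]; exact g.2
    have : 2 * g.1 1 1 * g.1 1 0 * g.1 0 0 + g.1 0 1 * g.1 1 0 ^ 2
        = g.1 1 0 * (3 * g.1 0 0 * g.1 1 1 - 1) := by
      linear_combination (- g.1 1 0) * hdet
    rw [this, mul_pow]
    split_ifs with h
    · rw [ZMod.pow_card_sub_one_eq_one h, one_mul]
    · push Not at h
      rw [h, zero_pow (by omega), zero_mul]
  have h2 : ∑ g ∈ Finset.univ.filter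
        (fun g : Matrix.SpecialLinearGroup (Fin 2) (ZMod p) => g.1 1 0 ≠ 0),
      (3 * g.1 0 0 * g.1 1 1 - 1) ^ (p - 1) =
      ∑ x : (ZMod p)ˣ × ZMod p × ZMod p, (3 * x.2.1 * x.2.2 - 1) ^ (p - 1) := by
    symm
    refine Finset.sum_bij (fun x _ => cell x) ?_ ?_ ?_ ?_
    · intro x _
      rw [Finset.mem_filter]
      refine ⟨Finset.mem_univ _, ?_⟩
      rw [cell10]
      exact x.1.ne_zero
    · intro x _ y _ hxy
      have h00 : (cell x).1 0 0 = (cell y).1 0 0 := by rw [hxy]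
      have h10 : (cell x).1 1 0 = (cell y).1 1 0 := by rw [hxy]
      have h11 : (cell x).1 1 1 = (cell y).1 1 1 := by rw [hxy]
      exact Prod.ext (Units.ext h10) (Prod.ext h00 h11)
    · intro g hg
      have hg' : g.1 1 0 ≠ 0 := (Finset.mem_filter.1 hg).2
      refine ⟨(Units.mk0 _ hg', g.1 0 0, g.1 1 1), Finset.mem_univ _, ?_⟩
      have hdet : g.1 0 0 * g.1 1 1 - g.1 0 1 * g.1 1 0 = 1 := by
        rw [← Matrix.det_fin_two]; exact g.2
      apply Subtype.ext
      ext i j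
      fin_cases i <;> fin_cases j
      · rfl
      · refine (cell01 _).trans ?_
        rw [Units.val_inv_eq_inv_val, Units.val_mk0]
        change (g.1 0 0 * g.1 1 1 - 1) * (g.1 1 0)⁻¹ = g.1 0 1
        rw [mul_inv_eq_iff_eq_mul₀ hg']
        linear_combination hdet
      · rfl
      · rfl
    · intro x _
      rw [cell00, cell11]
  rw [h1, h2, Fintype.sum_prod_type]
  simp only [Fintype.sum_prod_type, inner_sum_aux hp]
  have h4 : ∑ a : ZMod p, (if a = 0 then (0 : ZMod p) else -1) = 1 := by
    have : ∀ a : ZMod p, (if a = 0 then (0 : ZMod p) else -1) = -1 + if a = 0 then 1 else 0 := by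
      intro a; split_ifs <;> simp
    simp_rw [this]
    rw [Finset.sum_add_distrib]
    simp
  rw [h4]
  have hp1 : 1 ≤ p := by omega
  simp [ZMod.card_units_eq_totient, Nat.totient_prime (Fact.out : p.Prime), Nat.cast_sub hp1]

end count

section zeros
set_option linter.unusedSectionVars false
set_option linter.unusedSimpArgs false
variable {p : ℕ} [Fact p.Prime] {F : Type} [Field F] [CharP F p]
  {A : Type} [CommRing A] [IsDomain A] [Algebra F A]

/-- the binary cubic attached to a point -/
def cub (φ : MvPolynomial (Fin 4) F →ₐ[F] A) (x y : ZMod p) : A :=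
  φ (act p F !![y, x; 0, 0] (X 3))

theorem cub_eq (φ : MvPolynomial (Fin 4) F →ₐ[F] A) (g : Matrix (Fin 2) (Fin 2) (ZMod p)) :
    φ (act p F g (X 3)) = cub φ (g 0 1) (g 0 0) := by
  simp only [cub, act_X3]
  simp

theorem cub_eq0 (φ : MvPolynomial (Fin 4) F →ₐ[F] A) (g : Matrix (Fin 2) (Fin 2) (ZMod p)) :
    φ (act p F g (X 0)) = cub φ (g 1 1) (g 1 0) := by
  simp only [cub, act_X0, act_X3]
  simp

theorem cub_smul (φ : MvPolynomial (Fin 4) F →ₐ[F] A) (c x y : ZMod p) :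
    cub φ (c * x) (c * y) = φ (C (cc p F c)) ^ 3 * cub φ x y := by
  simp only [cub, act_X3]
  simp
  ring

theorem cub_smul_zero (φ : MvPolynomial (Fin 4) F →ₐ[F] A) (c x y x' y' : ZMod p)
    (h : cub φ x y = 0) (hx : x' = c * x) (hy : y' = c * y) : cub φ x' y' = 0 := by
  rw [hx, hy, cub_smul, h, mul_zero]

theorem eval_N (φ : MvPolynomial (Fin 4) F →ₐ[F] A) :
    φ (Npoly p F) = ∏ s : ZMod p, cub φ s 1 := by
  simp [Npoly, cub_eq]

theorem eval_actN (φ : MvPolynomial (Fin 4) F →ₐ[F] A) (t : ZMod p) :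
    φ (act p F !![1, 0; t, 1] (Npoly p F)) = ∏ s : ZMod p, cub φ s (1 + s * t) := by
  simp only [Npoly, map_prod, act_act]
  simp only [cub_eq]
  simp [Matrix.mul_apply, Fin.sum_univ_two]

theorem eval_actN' (φ : MvPolynomial (Fin 4) F →ₐ[F] A) :
    φ (act p F !![0, 1; -1, 0] (Npoly p F)) = ∏ s : ZMod p, cub φ 1 (-s) := by
  simp only [Npoly, map_prod, act_act]
  simp only [cub_eq]
  simp [Matrix.mul_apply, Fin.sum_univ_two]

theorem two_roots (φ : MvPolynomial (Fin 4) F →ₐ[F] A) (c : ℕ) (hc : 0 < c)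
    (hN : φ (Npoly p F * X 0) = 0) (hδ : φ (trBG p F (Npoly p F ^ c)) = 0) :
    ∃ x1 y1 x2 y2 : ZMod p, x1 * y2 - x2 * y1 ≠ 0 ∧ cub φ x1 y1 = 0 ∧ cub φ x2 y2 = 0 := by
  have h0 : φ (X 0) = cub φ (1 : ZMod p) 0 := by
    have := cub_eq0 φ (1 : Matrix (Fin 2) (Fin 2) (ZMod p))
    rw [act_one] at this
    simpa using this
  rw [map_mul, eval_N, h0, mul_eq_zero, Finset.prod_eq_zero_iff] at hN
  simp only [trBG, map_add, map_sum, map_pow, eval_actN, eval_actN'] at hδ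
  have hc' : c ≠ 0 := by omega
  rcases hN with ⟨s0, -, hs0⟩ | h10
  · by_cases hz : s0 = 0
    · subst hz
      have hT : ∀ t : ZMod p, (∏ s : ZMod p, cub φ s (1 + s * t)) ^ c = 0 := by
        intro t
        rw [Finset.prod_eq_zero (Finset.mem_univ 0) (by simpa using hs0), zero_pow hc']
      simp only [hT, Finset.sum_const_zero, zero_add] at hδ
      obtain ⟨s, -, hs⟩ := Finset.prod_eq_zero_iff.1 (eq_zero_of_pow_eq_zero hδ)
      exact ⟨0, 1, 1, -s, by simp, hs0, hs⟩
    · have hT : ∀ t : ZMod p, t ≠ s0⁻¹ → (∏ s : ZMod p, cub φ s (1 + s * t)) ^ c = 0 := by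
        intro t ht
        have hne : 1 - s0 * t ≠ 0 := by
          intro h
          apply ht
          field_simp
          linear_combination -h
        rw [Finset.prod_eq_zero (Finset.mem_univ ((1 - s0 * t)⁻¹ * s0)) ?_, zero_pow hc']
        refine cub_smul_zero φ (1 - s0 * t)⁻¹ s0 1 _ _ hs0 rfl ?_
        field_simp
        ring
      have hH : (∏ s : ZMod p, cub φ 1 (-s)) ^ c = 0 := by
        rw [Finset.prod_eq_zero (Finset.mem_univ (-s0⁻¹)) ?_, zero_pow hc']
        refine cub_smul_zero φ s0⁻¹ s0 1 _ _ hs0 ?_ (by simp)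
        field_simp
      rw [Finset.sum_eq_single s0⁻¹ (fun t _ ht => hT t ht) (by simp), hH, add_zero] at hδ
      obtain ⟨s, -, hs⟩ := Finset.prod_eq_zero_iff.1 (eq_zero_of_pow_eq_zero hδ)
      refine ⟨s0, 1, s, _, ?_, hs0, hs⟩
      have : s0 * (1 + s * s0⁻¹) - s * 1 = s0 := by field_simp; ring
      rwa [this]
  · have hT : ∀ t : ZMod p, t ≠ 0 → (∏ s : ZMod p, cub φ s (1 + s * t)) ^ c = 0 := by
      intro t ht
      rw [Finset.prod_eq_zero (Finset.mem_univ (-t⁻¹)) ?_, zero_pow hc']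
      refine cub_smul_zero φ (-t⁻¹) 1 0 _ _ h10 (by simp) ?_
      field_simp
      ring
    have hH : (∏ s : ZMod p, cub φ 1 (-s)) ^ c = 0 := by
      rw [Finset.prod_eq_zero (Finset.mem_univ 0) (by simpa using h10), zero_pow hc']
    rw [Finset.sum_eq_single 0 (fun t _ ht => hT t ht) (by simp), hH, add_zero] at hδ
    obtain ⟨s, -, hs⟩ := Finset.prod_eq_zero_iff.1 (eq_zero_of_pow_eq_zero hδ)
    exact ⟨1, 0, s, _, by simp, h10, hs⟩

theorem eval_K (hp : 3 < p) (φ : MvPolynomial (Fin 4) F →ₐ[F] A) (h0 : φ (X 0) = 0)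
    (h1 : φ (X 1) = 0) (h3 : φ (X 3) = 0) : φ (Kpoly p F) = φ (X 2) ^ (p - 1) := by
  have h : ∀ g : Matrix.SpecialLinearGroup (Fin 2) (ZMod p),
      φ (act p F g.1 (X 1 ^ (p - 1))) = φ (C (cc p F
        ((2 * g.1 1 1 * g.1 1 0 * g.1 0 0 + g.1 0 1 * g.1 1 0 ^ 2) ^ (p - 1))))
        * φ (X 2) ^ (p - 1) := by
    intro g
    simp only [map_pow, act_X1, map_add, map_mul, h0, h1, h3, mul_zero, zero_add, add_zero,
      map_ofNat, mul_pow]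
  simp only [Kpoly, trG, map_neg, map_sum, h]
  rw [← Finset.sum_mul, ← map_sum, ← map_sum, ← map_sum, sl2_sum hp]
  simp

theorem all_zero_of (φ : MvPolynomial (Fin 4) F →ₐ[F] A)
    (g : Matrix.SpecialLinearGroup (Fin 2) (ZMod p))
    (h : ∀ i, φ (act p F g.1 (X i)) = 0) : ∀ i, φ (X i) = 0 := by
  intro i
  have h1 : φ (X i) = (φ.comp (act p F g.1)) (act p F (g⁻¹).1 (X i)) := by
    rw [AlgHom.comp_apply, act_act]
    have : (g⁻¹).1 * g.1 = 1 := by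
      rw [← Matrix.SpecialLinearGroup.coe_mul]; simp
    rw [this, act_one]
  have h' : ∀ i, (φ.comp (act p F g.1)) (X i) = 0 := h
  rw [h1]
  generalize φ.comp (act p F g.1) = ψ at h'
  revert i
  refine forall_fin4 ?_ ?_ ?_ ?_ <;> intro _ <;>
    simp only [act_X0, act_X1, act_X2, act_X3, map_add, map_mul, h', mul_zero, add_zero]

theorem zero_last (hp : 3 < p) (φ : MvPolynomial (Fin 4) F →ₐ[F] A)
    (hK : φ (Kpoly p F) = 0) (h0 : φ (X 0) = 0)
    (h1 : φ (X 1) = 0) (h3 : φ (X 3) = 0) : ∀ i, φ (X i) = 0 := by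
  rw [eval_K hp φ h0 h1 h3] at hK
  exact forall_fin4 h0 h1 (eq_zero_of_pow_eq_zero hK) h3

theorem zero_mid (hp : 3 < p) (φ : MvPolynomial (Fin 4) F →ₐ[F] A)
    (hD : φ (Dpoly F) = 0) (hK : φ (Kpoly p F) = 0) (h0 : φ (X 0) = 0)
    (h3 : φ (X 3) = 0) : ∀ i, φ (X i) = 0 := by
  have h3F : (algebraMap F A 3) ≠ 0 := by
    rw [Ne, FaithfulSMul.algebraMap_eq_zero_iff]
    intro h
    have : ((3 : ℕ) : F) = 0 := by exact_mod_cast h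
    rw [CharP.cast_eq_zero_iff F p] at this
    exact absurd (Nat.le_of_dvd (by norm_num) this) (by omega)
  rw [map_ofNat] at h3F
  have hD' : (φ (X 2) * φ (X 1)) ^ 2 = 0 := by
    simp only [Dpoly, map_add, map_sub, map_mul, map_pow, h0, h3, map_ofNat] at hD
    have : 3 * (φ (X 2) * φ (X 1)) ^ 2 = 0 := by linear_combination hD
    exact (mul_eq_zero.1 this).resolve_left h3F
  rcases mul_eq_zero.1 (eq_zero_of_pow_eq_zero hD') with h2 | h1
  · let η : Matrix.SpecialLinearGroup (Fin 2) (ZMod p) :=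
      ⟨!![0, 1; -1, 0], by simp [Matrix.det_fin_two_of]⟩
    refine all_zero_of φ η ?_
    refine zero_last hp (φ.comp (act p F η.1)) ?_ ?_ ?_ ?_
    · rw [AlgHom.comp_apply, act_K, hK]
    · rw [AlgHom.comp_apply, act_X0]; simp [η, h0, h2, h3]
    · rw [AlgHom.comp_apply, act_X1]; simp [η, h0, h2, h3]
    · rw [AlgHom.comp_apply, act_X3]; simp [η, h0, h2, h3]
  · exact zero_last hp φ hK h0 h1 h3

theorem zero_main (hp : 3 < p) (φ : MvPolynomial (Fin 4) F →ₐ[F] A) (c : ℕ) (hc : 0 < c)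
    (hD : φ (Dpoly F) = 0) (hK : φ (Kpoly p F) = 0)
    (hN : φ (Npoly p F * X 0) = 0) (hδ : φ (trBG p F (Npoly p F ^ c)) = 0) :
    ∀ i, φ (X i) = 0 := by
  obtain ⟨x1, y1, x2, y2, hne, hr1, hr2⟩ := two_roots φ c hc hN hδ
  let g : Matrix.SpecialLinearGroup (Fin 2) (ZMod p) :=
    ⟨!![y2, x2; (x1 * y2 - x2 * y1)⁻¹ * y1, (x1 * y2 - x2 * y1)⁻¹ * x1], by
      rw [Matrix.det_fin_two_of]
      have := inv_mul_cancel₀ hne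
      linear_combination this⟩
  refine all_zero_of φ g ?_
  refine zero_mid hp (φ.comp (act p F g.1)) ?_ ?_ ?_ ?_
  · rw [AlgHom.comp_apply, act_D _ g.2, hD]
  · rw [AlgHom.comp_apply, act_K, hK]
  · rw [AlgHom.comp_apply, cub_eq0]
    exact cub_smul_zero φ (x1 * y2 - x2 * y1)⁻¹ x1 y1 _ _ hr1 (by simp [g]) (by simp [g])
  · rw [AlgHom.comp_apply, cub_eq]
    simpa [g] using hr2

end zeros

theorem pow_mem_of_le_aux {R : Type} [CommRing R] {I : Ideal R} {x : R} {m n : ℕ}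
    (h : x ^ m ∈ I) (hmn : m ≤ n) : x ^ n ∈ I :=
  I.mem_of_dvd (pow_dvd_pow x hmn) h

theorem finite_main {p : ℕ} [Fact p.Prime] (hp : 3 < p)
    (F : Type) [Field F] [CharP F p] (c : ℕ) (hc : 0 < c) :
    Module.Finite (Algebra.adjoin F (Set.range
      ![Dpoly F, Kpoly p F, Npoly p F * X 0, trBG p F (Npoly p F ^ c)]))
      (MvPolynomial (Fin 4) F) := by
  set θ := ![Dpoly F, Kpoly p F, Npoly p F * X 0, trBG p F (Npoly p F ^ c)] with hθ
  have hrad : ∀ i, (X i : MvPolynomial (Fin 4) F) ∈ (Ideal.span (Set.range θ)).radical := by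
    intro i
    rw [Ideal.radical_eq_sInf, Submodule.mem_sInf]
    rintro P ⟨hle, hP⟩
    have hm : ∀ j, Ideal.Quotient.mkₐ F P (θ j) = 0 := fun j =>
      Ideal.Quotient.eq_zero_iff_mem.2 (hle (Ideal.subset_span ⟨j, rfl⟩))
    exact Ideal.Quotient.eq_zero_iff_mem.1
      (zero_main hp (Ideal.Quotient.mkₐ F P) c hc (hm 0) (hm 1) (hm 2) (hm 3) i)
  choose n hn using hrad
  have hNh : (Npoly p F).IsHomogeneous p := by
    have := IsHomogeneous.prod (Finset.univ : Finset (ZMod p))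
      (fun s => act p F !![1, s; 0, 1] (X 3)) (fun _ => 1)
      (fun s _ => act_hom _ _ _ (isHomogeneous_X _ _))
    simpa [Npoly] using this
  refine fin_aux _ θ ![4, p - 1, p + 1, p * c] ?_ ?_ ?_ (∑ i, n i) ?_
  · refine forall_fin4 ?_ ?_ ?_ ?_
    · simp
    · simp; omega
    · simp
    · simp; exact ⟨by omega, hc⟩
  · refine forall_fin4 ?_ ?_ ?_ ?_
    · change (Dpoly F).IsHomogeneous 4
      have hx : ∀ i, (X i : MvPolynomial (Fin 4) F).IsHomogeneous 1 := isHomogeneous_X F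
      have hk : ∀ k : ℕ, [k.AtLeastTwo] → (OfNat.ofNat k : MvPolynomial (Fin 4) F).IsHomogeneous 0 := by
        intro k _
        rw [← map_ofNat (C : F →+* MvPolynomial (Fin 4) F) k]
        exact isHomogeneous_C _ _
      refine ((((?_ : IsHomogeneous _ _).sub ?_).sub ?_).add ?_).sub ?_
      · exact ((hk 3).mul ((hx 2).pow 2)).mul ((hx 1).pow 2)
      · exact ((hk 4).mul (hx 3)).mul ((hx 1).pow 3)
      · exact ((hk 4).mul ((hx 2).pow 3)).mul (hx 0)
      · exact ((((hk 6).mul (hx 3)).mul (hx 2)).mul (hx 1)).mul (hx 0)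
      · exact ((hx 3).pow 2).mul ((hx 0).pow 2)
    · change (Kpoly p F).IsHomogeneous (p - 1)
      exact (IsHomogeneous.sum _ _ _ fun g _ => act_hom _ _ _ (isHomogeneous_X_pow _ _)).neg
    · exact hNh.mul (isHomogeneous_X _ _)
    · change (trBG p F (Npoly p F ^ c)).IsHomogeneous (p * c)
      exact (IsHomogeneous.sum _ _ _ fun g _ => act_hom _ _ _ (hNh.pow c)).add
        (act_hom _ _ _ (hNh.pow c))
  · exact fun i => Algebra.subset_adjoin ⟨i, rfl⟩
  · intro i
    exact pow_mem_of_le_aux (hn i)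
      (Finset.single_le_sum (f := n) (fun _ _ => Nat.zero_le _) (Finset.mem_univ i))

/-- `{D, K, N·a₀, δ}` is a homogeneous system of parameters: the four
invariants are algebraically independent over `F`, and `F[V]` is a finitely generated
module over the subalgebra `F[D, K, N·a₀, δ]`.  Here `δ = tr_B^G(N^c)` with
`c = (p-1)/3` if `p ≡ 1 (mod 3)` and `c = p-1` if `p ≡ -1 (mod 3)`. -/
theorem hsop (p : ℕ) [Fact p.Prime] (hp : 3 < p)
    (F : Type) [Field F] [CharP F p] :
    AlgebraicIndependent F
      ![Dpoly F, Kpoly p F, Npoly p F * X 0,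
        trBG p F (Npoly p F ^ (if p % 3 = 1 then (p - 1) / 3 else p - 1))] ∧
    Module.Finite
      (Algebra.adjoin F ({Dpoly F, Kpoly p F, Npoly p F * X 0,
        trBG p F (Npoly p F ^ (if p % 3 = 1 then (p - 1) / 3 else p - 1))} :
          Set (MvPolynomial (Fin 4) F)))
      (MvPolynomial (Fin 4) F) := by
  have hc : 0 < (if p % 3 = 1 then (p - 1) / 3 else p - 1) := by
    split_ifs <;> omega
  have h := finite_main hp F _ hc
  refine ⟨algInd_aux _ h, ?_⟩
  have hr : ∀ a b c d : MvPolynomial (Fin 4) F, Set.range ![a, b, c, d] = {a, b, c, d} := by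
    intro a b c d
    simp only [Matrix.range_cons, Matrix.range_empty, Set.union_empty]
    rfl
  rw [hr] at h
  exact h

end
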